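/- Let r ≥ 3 be a natural number. The following 8(r−1) functions on SL(3,ℂ)^r are algebraically independent over ℂ in the ℂ-algebra of all functions SL(3,ℂ)^r → ℂ: the eight functions tr(X₁), tr(X₂), tr(X₁⁻¹), tr(X₂⁻¹), tr(X₁X₂), tr(X₁⁻¹X₂), tr(X₂⁻¹X₁), tr(X₁⁻¹X₂⁻¹), together with, for each k with 3 ≤ k ≤ r, the eight functions tr(X_k), tr(X_k⁻¹), tr(X₁X_k), tr(X₂X_k), tr(X₁X_k⁻¹), tr(X₁⁻¹X_k⁻¹), tr(X₁⁻¹X_k), tr(X₂⁻¹X_k). -/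

import Mathlib

/-- `SL(3,ℂ)`. -/
abbrev SL3 := Matrix.SpecialLinearGroup (Fin 3) ℂ

/-- Trace of an element of `SL(3,ℂ)`, as the trace of the underlying matrix. -/
noncomputable def tr3 (X : SL3) : ℂ := Matrix.trace (X : Matrix (Fin 3) (Fin 3) ℂ)

/-- The eight functions tr X₁, tr X₂, tr X₁⁻¹, tr X₂⁻¹, tr X₁X₂, tr X₁⁻¹X₂,
tr X₂⁻¹X₁, tr X₁⁻¹X₂⁻¹ (indices here are 0-based: X₁ = X 0, X₂ = X 1). -/
noncomputable def baseBlock (r : ℕ) (hr : 3 ≤ r) (j : Fin 8) (X : Fin r → SL3) : ℂ :=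
  ![tr3 (X ⟨0, by omega⟩),
    tr3 (X ⟨1, by omega⟩),
    tr3 (X ⟨0, by omega⟩)⁻¹,
    tr3 (X ⟨1, by omega⟩)⁻¹,
    tr3 (X ⟨0, by omega⟩ * X ⟨1, by omega⟩),
    tr3 ((X ⟨0, by omega⟩)⁻¹ * X ⟨1, by omega⟩),
    tr3 ((X ⟨1, by omega⟩)⁻¹ * X ⟨0, by omega⟩),
    tr3 ((X ⟨0, by omega⟩)⁻¹ * (X ⟨1, by omega⟩)⁻¹)] j

open Matrix Filter Topology

namespace TraceIndep

/-- Normed model of the space of 3×3 matrices (sup norm on entries). -/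
abbrev MM := Fin 3 → Fin 3 → ℂ

/-- The underlying matrix. -/
abbrev tm (A : MM) : Matrix (Fin 3) (Fin 3) ℂ := Matrix.of A

/-- The base map: two determinants and the eight base traces (adjugates replace inverses). -/
noncomputable def Fb (p : MM × MM) : (ℂ × ℂ) × (Fin 8 → ℂ) :=
  (((tm p.1).det, (tm p.2).det),
    ![(tm p.1).trace, (tm p.2).trace, (tm p.1).adjugate.trace, (tm p.2).adjugate.trace,
      (tm p.1 * tm p.2).trace, ((tm p.1).adjugate * tm p.2).trace,
      ((tm p.2).adjugate * tm p.1).trace, ((tm p.1).adjugate * (tm p.2).adjugate).trace])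

/-- The block map: the determinant and the eight traces of a further block. -/
noncomputable def Gb (q : (MM × MM) × MM) : ℂ × (Fin 8 → ℂ) :=
  ((tm q.2).det,
    ![(tm q.2).trace, (tm q.2).adjugate.trace,
      (tm q.1.1 * tm q.2).trace, (tm q.1.2 * tm q.2).trace,
      (tm q.1.1 * (tm q.2).adjugate).trace, ((tm q.1.1).adjugate * (tm q.2).adjugate).trace,
      ((tm q.1.1).adjugate * tm q.2).trace, ((tm q.1.2).adjugate * tm q.2).trace])

/-- A curve of matrices has entrywise derivative `V` at `0`. -/
def HD (A : ℂ → Matrix (Fin 3) (Fin 3) ℂ) (V : Matrix (Fin 3) (Fin 3) ℂ) : Prop :=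
  ∀ i j, HasDerivAt (fun t => A t i j) (V i j) 0

/-- Linearised adjugate. -/
def padj (A V : Matrix (Fin 3) (Fin 3) ℂ) : Matrix (Fin 3) (Fin 3) ℂ :=
  (A + V).adjugate - A.adjugate - V.adjugate

lemma HD.mul {A B V W} (hA : HD A V) (hB : HD B W) :
    HD (fun t => A t * B t) (V * B 0 + A 0 * W) := by
  intro i j
  simp only [Matrix.mul_apply, Matrix.add_apply, Fin.sum_univ_three]
  refine ((((hA i 0).mul (hB 0 j)).add ((hA i 1).mul (hB 1 j))).add
    ((hA i 2).mul (hB 2 j))).congr_deriv ?_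
  ring

lemma HD.trace {A V} (hA : HD A V) : HasDerivAt (fun t => (A t).trace) V.trace 0 := by
  simp only [Matrix.trace_fin_three]
  exact ((hA 0 0).add (hA 1 1)).add (hA 2 2)

lemma HD.adj {A V} (hA : HD A V) : HD (fun t => (A t).adjugate) (padj (A 0) V) := by
  have key : ∀ a b c d : Fin 3, HasDerivAt (fun t => A t a b * A t c d)
      (V a b * A 0 c d + A 0 a b * V c d) 0 := fun a b c d => (hA a b).mul (hA c d)
  intro i j
  simp only [padj, Matrix.adjugate_fin_three]
  fin_cases i <;> fin_cases j <;> simp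
  · exact ((key 1 1 2 2).sub (key 1 2 2 1)).congr_deriv (by ring)
  · exact ((key 0 1 2 2).neg.add (key 0 2 2 1)).congr_deriv (by ring)
  · exact ((key 0 1 1 2).sub (key 0 2 1 1)).congr_deriv (by ring)
  · exact ((key 1 0 2 2).neg.add (key 1 2 2 0)).congr_deriv (by ring)
  · exact ((key 0 0 2 2).sub (key 0 2 2 0)).congr_deriv (by ring)
  · exact ((key 0 0 1 2).neg.add (key 0 2 1 0)).congr_deriv (by ring)
  · exact ((key 1 0 2 1).sub (key 1 1 2 0)).congr_deriv (by ring)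
  · exact ((key 0 0 2 1).neg.add (key 0 1 2 0)).congr_deriv (by ring)
  · exact ((key 0 0 1 1).sub (key 0 1 1 0)).congr_deriv (by ring)

lemma HD.det {A V} (hA : HD A V) :
    HasDerivAt (fun t => (A t).det) ((A 0).adjugate * V).trace 0 := by
  have key : ∀ a b c d e f : Fin 3, HasDerivAt (fun t => A t a b * A t c d * A t e f)
      ((V a b * A 0 c d + A 0 a b * V c d) * A 0 e f + A 0 a b * A 0 c d * V e f) 0 :=
    fun a b c d e f => ((hA a b).mul (hA c d)).mul (hA e f)
  simp only [Matrix.det_fin_three]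
  refine ((((((key 0 0 1 1 2 2).sub (key 0 0 1 2 2 1)).sub (key 0 1 1 0 2 2)).add
    (key 0 1 1 2 2 0)).add (key 0 2 1 0 2 1)).sub (key 0 2 1 1 2 0)).congr_deriv ?_
  simp only [Matrix.trace_fin_three, Matrix.mul_apply, Fin.sum_univ_three]
  simp [Matrix.adjugate_fin_three]
  ring

lemma HD.const (A) : HD (fun _ => A) 0 := fun i j => hasDerivAt_const _ _

lemma HD.line (A V : MM) : HD (fun t => tm (A + t • V)) (tm V) := by
  intro i j
  simpa using ((hasDerivAt_id (0 : ℂ)).mul_const (V i j)).const_add (A i j)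

/-- A matrix from its entries. -/
def M3 (a b c d e f g h i : ℂ) : MM := ![![a, b, c], ![d, e, f], ![g, h, i]]

/-- Base points. -/
noncomputable def A0 : MM := M3 2 0 0 0 1 0 0 0 (1/2)
noncomputable def B0 : MM := M3 0 0 1 1 0 0 1 1 0
noncomputable def X0 : MM := M3 (-1) 1 0 (-1) 0 1 (-1) 0 2

lemma adjA0 : (tm A0).adjugate = tm (M3 (1/2) 0 0 0 1 0 0 0 2) := by
  rw [Matrix.adjugate_fin_three]
  ext i j; fin_cases i <;> fin_cases j <;> simp [A0, M3]

lemma adjB0 : (tm B0).adjugate = tm (M3 0 1 0 0 (-1) 1 1 0 0) := by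
  rw [Matrix.adjugate_fin_three]
  ext i j; fin_cases i <;> fin_cases j <;> simp [B0, M3]

lemma adjX0 : (tm X0).adjugate = tm (M3 0 (-2) 1 1 (-2) 1 0 (-1) 1) := by
  rw [Matrix.adjugate_fin_three]
  ext i j; fin_cases i <;> fin_cases j <;> simp [X0, M3] <;> norm_num

lemma detA0 : (tm A0).det = 1 := by simp [Matrix.det_fin_three, A0, M3]
lemma detB0 : (tm B0).det = 1 := by simp [Matrix.det_fin_three, B0, M3]
lemma detX0 : (tm X0).det = 1 := by simp [Matrix.det_fin_three, X0, M3]; norm_num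

lemma hasDerivAt_vec8 {f : Fin 8 → ℂ → ℂ} {w : Fin 8 → ℂ}
    (h0 : HasDerivAt (f 0) (w 0) 0) (h1 : HasDerivAt (f 1) (w 1) 0)
    (h2 : HasDerivAt (f 2) (w 2) 0) (h3 : HasDerivAt (f 3) (w 3) 0)
    (h4 : HasDerivAt (f 4) (w 4) 0) (h5 : HasDerivAt (f 5) (w 5) 0)
    (h6 : HasDerivAt (f 6) (w 6) 0) (h7 : HasDerivAt (f 7) (w 7) 0) :
    HasDerivAt (fun t => ![f 0 t, f 1 t, f 2 t, f 3 t, f 4 t, f 5 t, f 6 t, f 7 t]) w 0 := by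
  rw [hasDerivAt_pi]
  intro i
  fin_cases i <;> assumption

lemma base_dir (a b : ℂ) (w : Fin 8 → ℂ) : ∃ v : MM × MM,
    HasDerivAt (fun t : ℂ => Fb ((A0, B0) + t • v)) ((a, b), w) 0 := by
  refine ⟨(M3 ((2/3)*a + (8/3)*(w 0) + (-4/3)*(w 2))
      (0)
      (0)
      (0)
      ((-2)*a + (-2)*(w 0) + (2)*(w 2))
      (0)
      (0)
      (0)
      ((4/3)*a + (1/3)*(w 0) + (-2/3)*(w 2)),
    M3 ((-2)*(w 1) + (4/3)*(w 4) + (2/3)*(w 5))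
      ((-8/3)*a + (-4/3)*(w 0) + (4/3)*(w 2) + (2)*(w 3) + (-2/3)*(w 6) + (-4/3)*(w 7))
      (0)
      (0)
      ((5)*(w 1) + (-2)*(w 4) + (-2)*(w 5))
      ((2/3)*a + (4/3)*(w 0) + (-4/3)*(w 2) + (2)*(w 3) + (-4/3)*(w 6) + (-2/3)*(w 7))
      ((2)*a + (-5)*(w 3) + (2)*(w 6) + (2)*(w 7))
      ((1)*b + (5)*(w 1) + (-2)*(w 4) + (-2)*(w 5))
      ((-2)*(w 1) + (2/3)*(w 4) + (4/3)*(w 5))), ?_⟩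
  generalize hV : (M3 _ _ _ _ _ _ _ _ _) = V
  generalize hW : (M3 _ _ _ _ _ _ _ _ _) = W
  have hA := HD.line A0 V
  have hB := HD.line B0 W
  refine HasDerivAt.prodMk (HasDerivAt.prodMk (hA.det.congr_deriv ?_) (hB.det.congr_deriv ?_))
    (hasDerivAt_vec8
      (f := ![_, _, _, _, _, _, _, _])
      (hA.trace.congr_deriv ?_) (hB.trace.congr_deriv ?_)
      (hA.adj.trace.congr_deriv ?_) (hB.adj.trace.congr_deriv ?_)
      ((hA.mul hB).trace.congr_deriv ?_) ((hA.adj.mul hB).trace.congr_deriv ?_)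
      ((hB.adj.mul hA).trace.congr_deriv ?_) ((hA.adj.mul hB.adj).trace.congr_deriv ?_))
  all_goals
    try simp only [zero_smul, add_zero, padj, adjA0, adjB0]
    simp only [Matrix.trace_fin_three, Matrix.mul_apply, Fin.sum_univ_three]
    simp [Matrix.adjugate_fin_three, ← hV, ← hW, A0, B0, M3]
  all_goals try ring

lemma block_dir (a : ℂ) (w : Fin 8 → ℂ) : ∃ v : MM,
    HasDerivAt (fun t : ℂ => Gb (((A0, B0), X0) + t • ((0 : MM × MM), v))) (a, w) 0 := by
  refine ⟨M3 ((-2)*(w 0) + (4/3)*(w 2) + (2/3)*(w 6))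
      ((-2)*(w 0) + (-9)*(w 1) + (2)*(w 2) + (4)*(w 4) + (4)*(w 5) + (1)*(w 7))
      ((2)*(w 0) + (5)*(w 1) + (-2)*(w 2) + (-2)*(w 4) + (-2)*(w 5))
      ((-7)*(w 0) + (-7)*(w 1) + (4)*(w 2) + (10/3)*(w 4) + (8/3)*(w 5) + (2)*(w 6) + (1)*(w 7))
      ((5)*(w 0) + (-2)*(w 2) + (-2)*(w 6))
      ((-1/2)*a + (5)*(w 0) + (11/2)*(w 1) + (-8/3)*(w 2) + (1/2)*(w 3) + (-3)*(w 4) + (-2)*(w 5) + (-4/3)*(w 6) + (-1)*(w 7))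
      ((1/2)*a + (-5)*(w 0) + (-3/2)*(w 1) + (8/3)*(w 2) + (1/2)*(w 3) + (1)*(w 4) + (4/3)*(w 6))
      ((10)*(w 0) + (2)*(w 1) + (-4)*(w 2) + (-4/3)*(w 4) + (-2/3)*(w 5) + (-4)*(w 6))
      ((-2)*(w 0) + (2/3)*(w 2) + (4/3)*(w 6)), ?_⟩
  generalize hV : (M3 _ _ _ _ _ _ _ _ _) = V
  have hX := HD.line X0 V
  have hA := HD.line A0 0
  have hB := HD.line B0 0
  refine HasDerivAt.prodMk (hX.det.congr_deriv ?_)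
    (hasDerivAt_vec8
      (f := ![_, _, _, _, _, _, _, _])
      (hX.trace.congr_deriv ?_) (hX.adj.trace.congr_deriv ?_)
      ((hA.mul hX).trace.congr_deriv ?_) ((hB.mul hX).trace.congr_deriv ?_)
      ((hA.mul hX.adj).trace.congr_deriv ?_) ((hA.adj.mul hX.adj).trace.congr_deriv ?_)
      ((hA.adj.mul hX).trace.congr_deriv ?_) ((hB.adj.mul hX).trace.congr_deriv ?_))
  all_goals
    try simp only [zero_smul, add_zero, padj, adjA0, adjB0, adjX0]
    simp only [Matrix.trace_fin_three, Matrix.mul_apply, Fin.sum_univ_three]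
    simp [Matrix.adjugate_fin_three, ← hV, A0, B0, X0, M3]
  all_goals try ring

lemma contDiff_vec8 {E : Type*} [NormedAddCommGroup E] [NormedSpace ℂ E]
    {f0 f1 f2 f3 f4 f5 f6 f7 : E → ℂ}
    (h0 : ContDiff ℂ 1 f0) (h1 : ContDiff ℂ 1 f1) (h2 : ContDiff ℂ 1 f2) (h3 : ContDiff ℂ 1 f3)
    (h4 : ContDiff ℂ 1 f4) (h5 : ContDiff ℂ 1 f5) (h6 : ContDiff ℂ 1 f6) (h7 : ContDiff ℂ 1 f7) :
    ContDiff ℂ 1 (fun t => ![f0 t, f1 t, f2 t, f3 t, f4 t, f5 t, f6 t, f7 t]) := by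
  rw [contDiff_pi]
  intro i
  fin_cases i <;> assumption

lemma contDiff_Fb : ContDiff ℂ 1 Fb := by
  unfold Fb
  refine ContDiff.prodMk (ContDiff.prodMk ?_ ?_) (contDiff_vec8 ?_ ?_ ?_ ?_ ?_ ?_ ?_ ?_)
  all_goals
    simp only [Matrix.trace_fin_three, Matrix.mul_apply, Fin.sum_univ_three,
      Matrix.det_fin_three]
    simp [Matrix.adjugate_fin_three]
    fun_prop

lemma contDiff_Gb : ContDiff ℂ 1 Gb := by
  unfold Gb
  refine ContDiff.prodMk ?_ (contDiff_vec8 ?_ ?_ ?_ ?_ ?_ ?_ ?_ ?_)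
  all_goals
    simp only [Matrix.trace_fin_three, Matrix.mul_apply, Fin.sum_univ_three,
      Matrix.det_fin_three]
    simp [Matrix.adjugate_fin_three]
    fun_prop

lemma fderiv_of_line {E F : Type*} [NormedAddCommGroup E] [NormedSpace ℂ E]
    [NormedAddCommGroup F] [NormedSpace ℂ F] {f : E → F} {f' : E →L[ℂ] F} {x v : E} {w : F}
    (hf : HasStrictFDerivAt f f' x) (h : HasDerivAt (fun t : ℂ => f (x + t • v)) w 0) :
    f' v = w := by
  have h1 : HasDerivAt (fun t : ℂ => x + t • v) v 0 := by
    simpa using ((hasDerivAt_id (0 : ℂ)).smul_const v).const_add x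
  have h2 : HasFDerivAt f f' (x + (0 : ℂ) • v) := by simpa using hf.hasFDerivAt
  exact (h2.comp_hasDerivAt (0 : ℂ) h1).unique h

/-- The total map. -/
noncomputable def Tot (ι : Type) (q : (MM × MM) × (ι → MM)) :
    ((ℂ × ℂ) × (Fin 8 → ℂ)) × (ι → ℂ × (Fin 8 → ℂ)) :=
  (Fb q.1, fun k => Gb (q.1, q.2 k))

lemma tot_open (ι : Type) [Fintype ι] :
    Set.range (Tot ι) ∈ 𝓝 (Tot ι ((A0, B0), fun _ => X0)) := by
  have hF : HasStrictFDerivAt Fb (fderiv ℂ Fb (A0, B0)) (A0, B0) :=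
    contDiff_Fb.contDiffAt.hasStrictFDerivAt one_ne_zero
  have hG : HasStrictFDerivAt Gb (fderiv ℂ Gb ((A0, B0), X0)) ((A0, B0), X0) :=
    contDiff_Gb.contDiffAt.hasStrictFDerivAt one_ne_zero
  set F' := fderiv ℂ Fb (A0, B0)
  set G' := fderiv ℂ Gb ((A0, B0), X0)
  set q0 : (MM × MM) × (ι → MM) := ((A0, B0), fun _ => X0) with hq0
  have hfst : HasStrictFDerivAt (fun q : (MM × MM) × (ι → MM) => q.1)
    (ContinuousLinearMap.fst ℂ (MM × MM) (ι → MM)) q0 := hasStrictFDerivAt_fst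
  have hk : ∀ k : ι, HasStrictFDerivAt (fun q : (MM × MM) × (ι → MM) => (q.1, q.2 k))
      ((ContinuousLinearMap.fst ℂ (MM × MM) (ι → MM)).prod
        ((ContinuousLinearMap.proj (R := ℂ) (φ := fun _ : ι => MM) k).comp
          (ContinuousLinearMap.snd ℂ (MM × MM) (ι → MM)))) q0 :=
    fun k => ContinuousLinearMap.hasStrictFDerivAt
      ((ContinuousLinearMap.fst ℂ (MM × MM) (ι → MM)).prod
        ((ContinuousLinearMap.proj (R := ℂ) (φ := fun _ : ι => MM) k).comp
          (ContinuousLinearMap.snd ℂ (MM × MM) (ι → MM))))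
  have hT := HasStrictFDerivAt.prodMk (HasStrictFDerivAt.comp q0 (g := Fb) hF hfst)
    (hasStrictFDerivAt_pi.2 fun k => HasStrictFDerivAt.comp q0 (g := Gb) hG (hk k))
  have hm := hT.map_nhds_eq_of_surj (by
    rw [LinearMap.range_eq_top]
    rintro ⟨⟨⟨a, b⟩, w⟩, z⟩
    obtain ⟨v, hv⟩ := base_dir a b w
    have hv' := fderiv_of_line hF hv
    have hx : ∀ k, ∃ x : MM, G' ((0 : MM × MM), x) = z k - G' (v, 0) := by
      intro k
      obtain ⟨x, hx⟩ := block_dir (z k - G' (v, 0)).1 (z k - G' (v, 0)).2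
      exact ⟨x, fderiv_of_line hG hx⟩
    choose x hx using hx
    refine ⟨(v, x), ?_⟩
    refine Prod.ext hv' (funext fun k => ?_)
    change G' (v, x k) = z k
    have : ((v, x k) : (MM × MM) × MM) = (v, 0) + (0, x k) := by simp
    rw [this, map_add, hx]
    abel)
  have hr : Set.range (Tot ι) ∈ map (Tot ι) (𝓝 q0) :=
    Filter.mem_map.2 (Filter.univ_mem' fun q => Set.mem_range_self q)
  exact hm ▸ hr

lemma poly_zero {σ : Type*} [Fintype σ] (p : MvPolynomial σ ℂ) (z0 : σ → ℂ)
    {U : Set (σ → ℂ)} (hU : U ∈ 𝓝 z0) (h : ∀ z ∈ U, MvPolynomial.eval z p = 0) : p = 0 := by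
  obtain ⟨ε, hε, hb⟩ := Metric.mem_nhds_iff.1 hU
  refine MvPolynomial.funext_set (fun i => Metric.ball (z0 i) ε) (fun i => ?_) (fun z hz => ?_)
  · exact infinite_of_mem_nhds (z0 i) (Metric.ball_mem_nhds _ hε)
  · rw [map_zero]
    apply h z (hb _)
    rw [ball_pi _ hε]
    exact hz

/-- Insert the determinant values `1`. -/
def ins (ι : Type) (z : Fin 8 ⊕ (ι × Fin 8) → ℂ) :
    ((ℂ × ℂ) × (Fin 8 → ℂ)) × (ι → ℂ × (Fin 8 → ℂ)) :=
  (((1, 1), fun j => z (Sum.inl j)), fun k => (1, fun j => z (Sum.inr (k, j))))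

lemma continuous_ins (ι : Type) : Continuous (ins ι) := by
  unfold ins; fun_prop

lemma aeval_fun {σ S : Type*} (f : σ → S → ℂ) (p : MvPolynomial σ ℂ) (X : S) :
    (MvPolynomial.aeval f p) X = MvPolynomial.eval (fun i => f i X) p := by
  induction p using MvPolynomial.induction_on with
  | C a => simp [MvPolynomial.aeval_C]
  | add p q hp hq => simp [hp, hq]
  | mul_X p i hp => simp [hp]

end TraceIndep

open TraceIndep in
theorem trace_functions_algebraically_independent
    (r : ℕ) (hr : 3 ≤ r) :
    AlgebraicIndependent ℂ
      (Sum.elim (fun j : Fin 8 => baseBlock r hr j)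
        (fun p : {k : Fin r // 2 ≤ (k : ℕ)} × Fin 8 => fun X : Fin r → SL3 =>
          ![tr3 (X p.1.1),
            tr3 (X p.1.1)⁻¹,
            tr3 (X ⟨0, by omega⟩ * X p.1.1),
            tr3 (X ⟨1, by omega⟩ * X p.1.1),
            tr3 (X ⟨0, by omega⟩ * (X p.1.1)⁻¹),
            tr3 ((X ⟨0, by omega⟩)⁻¹ * (X p.1.1)⁻¹),
            tr3 ((X ⟨0, by omega⟩)⁻¹ * X p.1.1),
            tr3 ((X ⟨1, by omega⟩)⁻¹ * X p.1.1)] p.2)) := by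
  rw [algebraicIndependent_iff]
  set ι := {k : Fin r // 2 ≤ (k : ℕ)} with hι
  intro p hp
  set y0 := Tot ι ((A0, B0), fun _ => X0) with hy0
  let z0 : Fin 8 ⊕ (ι × Fin 8) → ℂ := Sum.elim (fun j => y0.1.2 j) (fun q => (y0.2 q.1).2 q.2)
  have hz0 : ins ι z0 = y0 := by
    refine Prod.ext (Prod.ext (Prod.ext ?_ ?_) rfl) (funext fun k => Prod.ext ?_ rfl)
    · exact detA0.symm
    · exact detB0.symm
    · exact detX0.symm
  have hU : ins ι ⁻¹' Set.range (Tot ι) ∈ 𝓝 z0 := by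
    apply (continuous_ins ι).continuousAt
    rw [hz0]
    exact tot_open ι
  refine poly_zero p z0 hU ?_
  rintro z ⟨⟨⟨A, B⟩, x⟩, hz⟩
  have hdA : (tm A).det = 1 := congrArg (fun y => y.1.1.1) hz
  have hdB : (tm B).det = 1 := congrArg (fun y => y.1.1.2) hz
  have hdx : ∀ k, (tm (x k)).det = 1 := fun k => congrArg (fun y => (y.2 k).1) hz
  let X : Fin r → SL3 := fun k =>
    if h : 2 ≤ (k : ℕ) then ⟨tm (x ⟨k, h⟩), hdx _⟩
    else if (k : ℕ) = 0 then ⟨tm A, hdA⟩ else ⟨tm B, hdB⟩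
  have hX0 : X ⟨0, by omega⟩ = ⟨tm A, hdA⟩ := by simp [X]; rfl
  have hX1 : X ⟨1, by omega⟩ = ⟨tm B, hdB⟩ := by simp [X]; rfl
  have hXk : ∀ k : ι, X k.1 = ⟨tm (x k), hdx k⟩ := fun k => by
    have := k.2
    simp [X, this]; rfl
  have hpX := congrFun hp X
  rw [aeval_fun] at hpX
  refine Eq.trans (congrArg (fun y => MvPolynomial.eval y p) ?_) hpX
  funext i
  rcases i with j | ⟨k, j⟩
  · have h1 : z (Sum.inl j) = (Fb (A, B)).2 j := (congrArg (fun y => y.1.2 j) hz).symm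
    rw [h1]
    simp only [Sum.elim_inl, baseBlock, hX0, hX1]
    fin_cases j <;> rfl
  · have h1 : z (Sum.inr (k, j)) = (Gb ((A, B), x k)).2 j :=
      (congrArg (fun y => (y.2 k).2 j) hz).symm
    rw [h1]
    simp only [Sum.elim_inr, hX0, hX1, hXk]
    fin_cases j <;> rfl
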